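/- For each choice of sign, the assignment s_i ↦ ŝ_i^± (i = 1,…,n−1) defines an action of the symmetric group S_n on ℂ(z_1,…,z_n,h); that is, the scalar operators ŝ_i^± satisfy (ŝ_i^±)² = id, ŝ_i^± ŝ_j^± = ŝ_j^± ŝ_i^± for |i−j| > 1, and ŝ_i^± ŝ_{i+1}^± ŝ_i^± = ŝ_{i+1}^± ŝ_i^± ŝ_{i+1}^±. -/

import Mathlib

open scoped BigOperators

noncomputable section

namespace GRTV

/-- The field `ℂ(z_1,…,z_n,h)` of rational functions. -/
abbrev K (n : ℕ) : Type := FractionRing (MvPolynomial (Fin n ⊕ Unit) ℂ)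

/-- The variable `z_i`. -/
def z {n : ℕ} (i : Fin n) : K n :=
  algebraMap (MvPolynomial (Fin n ⊕ Unit) ℂ) (K n) (MvPolynomial.X (Sum.inl i))

/-- The variable `h`. -/
def hvar {n : ℕ} : K n :=
  algebraMap (MvPolynomial (Fin n ⊕ Unit) ℂ) (K n) (MvPolynomial.X (Sum.inr ()))

/-- The field automorphism of `ℂ(z_1,…,z_n,h)` permuting the variables `z_i` by `σ`
(and fixing `h`); `f ↦ f^σ`. -/
def permK {n : ℕ} (σ : Equiv.Perm (Fin n)) : K n ≃+* K n :=
  IsFractionRing.ringEquivOfRingEquiv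
    (MvPolynomial.renameEquiv ℂ (Equiv.sumCongr σ (Equiv.refl Unit))).toRingEquiv

/-- `V ⊗ ℂ(z_1,…,z_n,h)` in coordinates: a vector is the family of its coordinates
in the basis `{v_I}`, where a basis index (a decomposition `I`) is recorded as the word
`m : Fin n → Fin N` with `I_j = m⁻¹(j)`. -/
abbrev VV (n N : ℕ) : Type := (Fin n → Fin N) → K n

/-- `h` for the `+` case (`ε = true`) and `-h` for the `−` case (`ε = false`). -/
def sign' {n : ℕ} (ε : Bool) : K n := if ε then hvar else -hvar

def fin1 {n : ℕ} (i : ℕ) (hi : i + 1 < n) : Fin n := ⟨i, Nat.lt_of_succ_lt hi⟩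
def fin2 {n : ℕ} (i : ℕ) (hi : i + 1 < n) : Fin n := ⟨i + 1, hi⟩

/-- The scalar operator `ŝ_i^±` on `ℂ(z_1,…,z_n,h)`:
`ŝ_i^± f = (z_i−z_{i+1} ± h)/(z_i−z_{i+1}) · f^{s_i} ∓ h/(z_i−z_{i+1}) · f`. -/
def hOp {n : ℕ} (ε : Bool) (i : ℕ) (hi : i + 1 < n) (f : K n) : K n :=
  ((z (fin1 i hi) - z (fin2 i hi) + sign' ε) *
      permK (Equiv.swap (fin1 i hi) (fin2 i hi)) f
    - sign' ε * f) / (z (fin1 i hi) - z (fin2 i hi))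

/-- The operator `f ↦ ((a - b + h) * σ f - h * f) / (a - b)` on a field with automorphism `σ`. -/
def demazureOp {F : Type*} [Field F] (σ : F ≃+* F) (a b h f : F) : F :=
  ((a - b + h) * σ f - h * f) / (a - b)

section Field

variable {F : Type*} [Field F] {σ τ : F ≃+* F} {a b c d h : F}

theorem demazureOp_involutive (hab : a ≠ b) (σa : σ a = b) (σb : σ b = a) (σh : σ h = h)
    (σσ : ∀ x, σ (σ x) = x) (f : F) :
    demazureOp σ a b h (demazureOp σ a b h f) = f := by
  have h₁ : a - b ≠ 0 := sub_ne_zero.2 hab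
  have h₂ : b - a ≠ 0 := sub_ne_zero.2 hab.symm
  simp only [demazureOp, map_div₀, map_sub, map_add, map_mul, σa, σb, σh, σσ]
  rw [← neg_sub a b]
  field_simp
  ring

theorem demazureOp_comm (hab : a ≠ b) (hcd : c ≠ d)
    (σc : σ c = c) (σd : σ d = d) (σh : σ h = h) (τa : τ a = a) (τb : τ b = b) (τh : τ h = h)
    (στ : ∀ x, σ (τ x) = τ (σ x)) (f : F) :
    demazureOp σ a b h (demazureOp τ c d h f) = demazureOp τ c d h (demazureOp σ a b h f) := by
  have h₁ : a - b ≠ 0 := sub_ne_zero.2 hab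
  have h₂ : c - d ≠ 0 := sub_ne_zero.2 hcd
  simp only [demazureOp, map_div₀, map_sub, map_add, map_mul, σc, σd, σh, τa, τb, τh, στ]
  field_simp
  ring

theorem demazureOp_braid (hab : a ≠ b) (hbc : b ≠ c) (hac : a ≠ c)
    (σa : σ a = b) (σb : σ b = a) (σc : σ c = c) (σh : σ h = h)
    (τa : τ a = a) (τb : τ b = c) (τc : τ c = b) (τh : τ h = h)
    (σσ : ∀ x, σ (σ x) = x) (ττ : ∀ x, τ (τ x) = x)
    (στ : ∀ x, σ (τ (σ x)) = τ (σ (τ x))) (f : F) :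
    demazureOp σ a b h (demazureOp τ b c h (demazureOp σ a b h f)) =
      demazureOp τ b c h (demazureOp σ a b h (demazureOp τ b c h f)) := by
  have h₁ : a - b ≠ 0 := sub_ne_zero.2 hab
  have h₂ : b - c ≠ 0 := sub_ne_zero.2 hbc
  have h₃ : a - c ≠ 0 := sub_ne_zero.2 hac
  simp only [demazureOp, map_div₀, map_sub, map_add, map_mul, σa, σb, σc, σh, τa, τb, τc, τh,
    σσ, ττ, στ]
  rw [← neg_sub a b, ← neg_sub b c]
  field_simp
  ring

end Field

section PermK

variable {n : ℕ}

theorem permK_z (σ : Equiv.Perm (Fin n)) (i : Fin n) : permK σ (z i) = z (σ i) := by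
  simp [permK, z]

theorem permK_hvar (σ : Equiv.Perm (Fin n)) : permK σ (hvar : K n) = hvar := by
  simp [permK, hvar]

theorem permK_sign' (σ : Equiv.Perm (Fin n)) (ε : Bool) : permK σ (sign' ε) = sign' ε := by
  cases ε <;> simp [sign', permK_hvar]

theorem permK_mul (σ τ : Equiv.Perm (Fin n)) (f : K n) :
    permK (σ * τ) f = permK σ (permK τ f) := by
  suffices h : (permK (σ * τ) : K n →+* K n) =
      (permK σ : K n →+* K n).comp (permK τ : K n →+* K n) from
    RingHom.congr_fun h f
  apply IsLocalization.ringHom_ext (nonZeroDivisors (MvPolynomial (Fin n ⊕ Unit) ℂ))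
  ext x
  · simp [permK]
  · rcases x with x | x <;> simp [permK]

theorem permK_one (f : K n) : permK 1 f = f := by
  have h := permK_mul 1 1 f
  rw [mul_one] at h
  exact ((permK 1).injective h).symm

theorem z_injective : Function.Injective (z : Fin n → K n) := fun i j h ↦ by
  simpa using MvPolynomial.X_injective (IsFractionRing.injective _ _ h)

end PermK

section Coxeter

variable {G : Type*} [Group G]

/-- The product `g k * g (k + 1) * ⋯ * g (k + d - 1)`. -/
def ascProd (g : ℕ → G) (k : ℕ) : ℕ → G
  | 0 => 1
  | d + 1 => g k * ascProd g (k + 1) d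

/-- The Coxeter relations of type `A` for `g 0, …, g (n - 2)`. -/
structure IsCoxeterFamily (n : ℕ) (g : ℕ → G) : Prop where
  mul_self : ∀ i, i + 1 < n → g i * g i = 1
  comm : ∀ i j, i + 1 < j → j + 1 < n → g i * g j = g j * g i
  braid : ∀ i, i + 2 < n → g i * g (i + 1) * g i = g (i + 1) * g i * g (i + 1)

variable {n : ℕ} {g : ℕ → G}

theorem IsCoxeterFamily.mul_ascProd_of_lt (hg : IsCoxeterFamily n g) {j k d : ℕ} (hj : j + 1 < k)
    (hd : k + d < n) : g j * ascProd g k d = ascProd g k d * g j := by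
  induction d generalizing k with
  | zero => simp [ascProd]
  | succ d ih =>
    rw [ascProd, ← mul_assoc, hg.comm j k hj (by omega), mul_assoc, ih (by omega) (by omega),
      mul_assoc]

theorem IsCoxeterFamily.mul_ascProd_of_mem (hg : IsCoxeterFamily n g) {j k d : ℕ} (hk : k ≤ j)
    (hj : j + 1 < k + d) (hd : k + d < n) :
    g (j + 1) * ascProd g k d = ascProd g k d * g j := by
  induction d generalizing k with
  | zero => omega
  | succ d ih =>
    rcases hk.eq_or_lt with rfl | hk
    · obtain ⟨d, rfl⟩ := Nat.exists_eq_add_one_of_ne_zero (n := d) (by omega)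
      rw [ascProd, ascProd, ← mul_assoc, ← mul_assoc, ← hg.braid k (by omega), mul_assoc _ (g k),
        hg.mul_ascProd_of_lt (by omega) (by omega)]
      simp only [mul_assoc]
    · rw [ascProd, ← mul_assoc, ← hg.comm k (j + 1) (by omega) (by omega), mul_assoc,
        ih (by omega) (by omega) (by omega), mul_assoc]

/-- The subgroup generated by `g 0, …, g (m - 2)`. -/
def parabolic (g : ℕ → G) (m : ℕ) : Subgroup G :=
  Subgroup.closure {x | ∃ i, i + 1 < m ∧ g i = x}

theorem mem_parabolic {m i : ℕ} (hi : i + 1 < m) : g i ∈ parabolic g m :=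
  Subgroup.subset_closure ⟨i, hi, rfl⟩

theorem IsCoxeterFamily.exists_eq_ascProd_mul (hg : IsCoxeterFamily n g) {m : ℕ} (hm : m < n)
    {x : G} (hx : x ∈ parabolic g (m + 1)) :
    ∃ k d, k + d = m ∧ ∃ y ∈ parabolic g m, x = ascProd g k d * y := by
  have step : ∀ j, j < m → ∀ x, (∃ k d, k + d = m ∧ ∃ y ∈ parabolic g m, x = ascProd g k d * y) →
      ∃ k d, k + d = m ∧ ∃ y ∈ parabolic g m, g j * x = ascProd g k d * y := by
    rintro j hj _ ⟨k, d, hkd, y, hy, rfl⟩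
    rcases lt_trichotomy j k with h | rfl | h
    · rcases (Nat.succ_le_of_lt h).eq_or_lt with rfl | h
      · exact ⟨j, d + 1, by omega, y, hy, by simp [ascProd, mul_assoc]⟩
      · exact ⟨k, d, hkd, g j * y, mul_mem (mem_parabolic (by omega)) hy, by
          rw [← mul_assoc, hg.mul_ascProd_of_lt h (by omega), mul_assoc]⟩
    · obtain ⟨d, rfl⟩ := Nat.exists_eq_add_one_of_ne_zero (n := d) (by omega)
      exact ⟨j + 1, d, by omega, y, hy, by
        rw [ascProd, ← mul_assoc, ← mul_assoc, hg.mul_self j (by omega), one_mul]⟩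
    · obtain ⟨j, rfl⟩ := Nat.exists_eq_add_one_of_ne_zero (n := j) (by omega)
      exact ⟨k, d, hkd, g j * y, mul_mem (mem_parabolic (by omega)) hy, by
          rw [← mul_assoc, hg.mul_ascProd_of_mem (by omega) (by omega) (by omega), mul_assoc]⟩
  refine Subgroup.closure_induction_left
    (p := fun x _ ↦ ∃ k d, k + d = m ∧ ∃ y ∈ parabolic g m, x = ascProd g k d * y)
    ⟨m, 0, rfl, 1, one_mem _, by simp [ascProd]⟩ ?_ ?_ hx
  · rintro _ ⟨j, hj, rfl⟩ y _ h
    exact step j (by omega) y h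
  · rintro _ ⟨j, hj, rfl⟩ y _ h
    rw [inv_eq_of_mul_eq_one_left (hg.mul_self j (by omega))]
    exact step j (by omega) y h

/-- The adjacent transposition `(i, i + 1)` of `Fin n`, or `1` if `i + 1` is out of range. -/
def adjSwap (n i : ℕ) : Equiv.Perm (Fin n) :=
  if hi : i + 1 < n then Equiv.swap (fin1 i hi) (fin2 i hi) else 1

theorem isCoxeterFamily_adjSwap (n : ℕ) : IsCoxeterFamily n (adjSwap n) where
  mul_self i hi := by simp [adjSwap, hi]
  comm i j hij hj := by
    ext x
    simp only [adjSwap, hj, show i + 1 < n by omega, dite_true, Equiv.Perm.mul_apply,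
      Equiv.swap_apply_def, fin1, fin2]
    grind
  braid i hi := by
    ext x
    simp only [adjSwap, show i + 1 < n by omega, show i + 1 + 1 < n by omega, dite_true,
      Equiv.Perm.mul_apply, Equiv.swap_apply_def, fin1, fin2]
    grind

theorem closure_adjSwap (n : ℕ) : parabolic (adjSwap n) n = ⊤ := by
  rcases n with _ | n
  · exact Subsingleton.elim _ _
  rw [eq_top_iff, ← Subgroup.toSubmonoid_le, Subgroup.top_toSubmonoid,
    ← Equiv.Perm.mclosure_swap_castSucc_succ, Submonoid.closure_le]
  rintro _ ⟨i, rfl⟩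
  have : adjSwap (n + 1) i ∈ parabolic (adjSwap (n + 1)) (n + 1) := mem_parabolic (by omega)
  rwa [adjSwap, dif_pos (by omega)] at this

theorem map_parabolic {H : Type*} [Group H] (φ : G →* H) (g : ℕ → G) (m : ℕ) :
    (parabolic g m).map φ = parabolic (φ ∘ g) m := by
  rw [parabolic, MonoidHom.map_closure]
  congr 1
  ext
  simp

theorem parabolic_adjSwap_apply {m : ℕ} {σ : Equiv.Perm (Fin n)}
    (hσ : σ ∈ parabolic (adjSwap n) m) {x : Fin n} (hx : m ≤ x) : σ x = x := by
  suffices parabolic (adjSwap n) m ≤ MulAction.stabilizer _ x from this hσ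
  rw [parabolic, Subgroup.closure_le]
  rintro _ ⟨i, hi, rfl⟩
  have := x.2
  simp only [SetLike.mem_coe, MulAction.mem_stabilizer_iff, Equiv.Perm.smul_def, adjSwap,
    show i + 1 < n by omega, dite_true]
  apply Equiv.swap_apply_of_ne_of_ne <;> simp [fin1, fin2, Fin.ext_iff] <;> omega

theorem ascProd_adjSwap_apply {k d : ℕ} (h : k + d < n) :
    ascProd (adjSwap n) k d ⟨k + d, h⟩ = ⟨k, by omega⟩ := by
  induction d generalizing k with
  | zero => simp [ascProd]
  | succ d ih =>
    have := ih (k := k + 1) (by omega)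
    simp only [show k + 1 + d = k + (d + 1) by omega] at this
    rw [ascProd, Equiv.Perm.mul_apply, this]
    simp [adjSwap, show k + 1 < n by omega, fin1, fin2]

theorem map_ascProd {H : Type*} [Group H] (φ : G →* H) (g : ℕ → G) (k d : ℕ) :
    φ (ascProd g k d) = ascProd (φ ∘ g) k d := by
  induction d generalizing k with
  | zero => simp [ascProd]
  | succ d ih => simp [ascProd, ih]

theorem IsCoxeterFamily.eq_one_of_map_eq_one (hg : IsCoxeterFamily n g)
    (φ : G →* Equiv.Perm (Fin n)) (hφ : φ ∘ g = adjSwap n) {m : ℕ} (hm : m ≤ n) {x : G}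
    (hx : x ∈ parabolic g m) (h : φ x = 1) : x = 1 := by
  induction m generalizing x with
  | zero => simpa [parabolic] using hx
  | succ m ih =>
    obtain ⟨k, d, hkd, y, hy, rfl⟩ := hg.exists_eq_ascProd_mul hm hx
    have hy' : φ y ∈ parabolic (adjSwap n) m := by
      rw [← hφ, ← map_parabolic]
      exact Subgroup.mem_map_of_mem φ hy
    subst hkd
    have hk := ascProd_adjSwap_apply (n := n) (k := k) (d := d) hm
    have hfix := Equiv.congr_fun h ⟨k + d, hm⟩
    rw [map_mul, map_ascProd, hφ, Equiv.Perm.mul_apply, parabolic_adjSwap_apply hy' le_rfl, hk]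
      at hfix
    obtain rfl : d = 0 := by simpa using hfix
    rw [ascProd, one_mul] at h ⊢
    exact ih (by omega) hy h

/-- The symmetric group has the Coxeter presentation of type `A`. -/
theorem IsCoxeterFamily.exists_monoidHom (hg : IsCoxeterFamily n g) :
    ∃ ρ : Equiv.Perm (Fin n) →* G, ∀ i, i + 1 < n → ρ (adjSwap n i) = g i := by
  let p : ℕ → Equiv.Perm (Fin n) × G := fun i ↦ (adjSwap n i, g i)
  have hs := isCoxeterFamily_adjSwap n
  have hp : IsCoxeterFamily n p :=
    { mul_self := fun i hi ↦ Prod.ext (hs.mul_self i hi) (hg.mul_self i hi)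
      comm := fun i j hij hj ↦ Prod.ext (hs.comm i j hij hj) (hg.comm i j hij hj)
      braid := fun i hi ↦ Prod.ext (hs.braid i hi) (hg.braid i hi) }
  let π := (MonoidHom.fst (Equiv.Perm (Fin n)) G).comp (parabolic p n).subtype
  have hπ : Function.Bijective π := by
    refine ⟨(injective_iff_map_eq_one π).2 fun x hx ↦ Subtype.ext <|
      hp.eq_one_of_map_eq_one (MonoidHom.fst _ _) rfl le_rfl x.2 hx, fun σ ↦ ?_⟩
    have hσ : σ ∈ (parabolic p n).map (MonoidHom.fst _ _) := by
      rw [map_parabolic]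
      exact (closure_adjSwap n).ge trivial
    obtain ⟨x, hx, rfl⟩ := hσ
    exact ⟨⟨x, hx⟩, rfl⟩
  let e := MulEquiv.ofBijective π hπ
  refine ⟨((MonoidHom.snd _ G).comp (parabolic p n).subtype).comp e.symm.toMonoidHom,
    fun i hi ↦ ?_⟩
  have he : e.symm (adjSwap n i) = ⟨p i, mem_parabolic hi⟩ := e.symm_apply_eq.2 rfl
  simp [he, p]

end Coxeter

section HOp

variable {n : ℕ}

theorem hOp_eq_demazureOp (ε : Bool) (i : ℕ) (hi : i + 1 < n) (f : K n) :
    hOp ε i hi f = demazureOp (permK (Equiv.swap (fin1 i hi) (fin2 i hi)))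
      (z (fin1 i hi)) (z (fin2 i hi)) (sign' ε) f := rfl

theorem adjSwap_of_lt {i : ℕ} (hi : i + 1 < n) :
    adjSwap n i = Equiv.swap (fin1 i hi) (fin2 i hi) := dif_pos hi

theorem hOp_hOp (ε : Bool) (i : ℕ) (hi : i + 1 < n) (f : K n) :
    hOp ε i hi (hOp ε i hi f) = f := by
  simp only [hOp_eq_demazureOp]
  apply demazureOp_involutive
  · exact z_injective.ne (by simp [fin1, fin2])
  · simp [permK_z]
  · simp [permK_z]
  · exact permK_sign' _ _
  · intro x
    rw [← permK_mul, Equiv.swap_mul_self, permK_one]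

theorem hOp_comm (ε : Bool) (i j : ℕ) (hi : i + 1 < n) (hj : j + 1 < n) (hij : i + 1 < j)
    (f : K n) : hOp ε i hi (hOp ε j hj f) = hOp ε j hj (hOp ε i hi f) := by
  simp only [hOp_eq_demazureOp]
  apply demazureOp_comm
  · exact z_injective.ne (by simp [fin1, fin2])
  · exact z_injective.ne (by simp [fin1, fin2])
  · rw [permK_z, Equiv.swap_apply_of_ne_of_ne] <;> simp [fin1, fin2] <;> omega
  · rw [permK_z, Equiv.swap_apply_of_ne_of_ne] <;> simp [fin1, fin2] <;> omega
  · exact permK_sign' _ _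
  · rw [permK_z, Equiv.swap_apply_of_ne_of_ne] <;> simp [fin1, fin2] <;> omega
  · rw [permK_z, Equiv.swap_apply_of_ne_of_ne] <;> simp [fin1, fin2] <;> omega
  · exact permK_sign' _ _
  · intro x
    rw [← permK_mul, ← permK_mul, ← adjSwap_of_lt, ← adjSwap_of_lt,
      (isCoxeterFamily_adjSwap n).comm i j hij hj]

theorem hOp_braid (ε : Bool) (i : ℕ) (hi : i + 1 < n) (hi2 : i + 1 + 1 < n) (f : K n) :
    hOp ε i hi (hOp ε (i + 1) hi2 (hOp ε i hi f)) =
      hOp ε (i + 1) hi2 (hOp ε i hi (hOp ε (i + 1) hi2 f)) := by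
  simp only [hOp_eq_demazureOp]
  rw [show fin1 (i + 1) hi2 = fin2 i hi from rfl]
  apply demazureOp_braid
  · exact z_injective.ne (by simp [fin1, fin2])
  · exact z_injective.ne (by simp [fin2])
  · exact z_injective.ne (by simp [fin1, fin2]; omega)
  · simp [permK_z]
  · simp [permK_z]
  · rw [permK_z, Equiv.swap_apply_of_ne_of_ne] <;> simp [fin1, fin2]; omega
  · exact permK_sign' _ _
  · rw [permK_z, Equiv.swap_apply_of_ne_of_ne] <;> simp [fin1, fin2]; omega
  · simp [permK_z]
  · simp [permK_z]
  · exact permK_sign' _ _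
  · intro x
    rw [← permK_mul, Equiv.swap_mul_self, permK_one]
  · intro x
    rw [← permK_mul, Equiv.swap_mul_self, permK_one]
  · intro x
    have := (isCoxeterFamily_adjSwap n).braid i hi2
    rw [adjSwap_of_lt hi, adjSwap_of_lt hi2] at this
    simp only [← permK_mul, ← mul_assoc]
    exact congrArg (permK · x) this

/-- `hOp` as a permutation of `K n`, extended by `1` to out-of-range indices. -/
def hOpPerm (n : ℕ) (ε : Bool) (i : ℕ) : Equiv.Perm (K n) :=
  if hi : i + 1 < n then Function.Involutive.toPerm (hOp ε i hi) (hOp_hOp ε i hi) else 1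

theorem hOpPerm_apply (ε : Bool) {i : ℕ} (hi : i + 1 < n) (f : K n) :
    hOpPerm n ε i f = hOp ε i hi f := by
  rw [hOpPerm, dif_pos hi]
  rfl

theorem isCoxeterFamily_hOpPerm (n : ℕ) (ε : Bool) : IsCoxeterFamily n (hOpPerm n ε) where
  mul_self i hi := by
    ext1 f
    simp only [Equiv.Perm.mul_apply, hOpPerm_apply ε hi, hOp_hOp, Equiv.Perm.one_apply]
  comm i j hij hj := by
    have hi : i + 1 < n := by omega
    ext1 f
    simp only [Equiv.Perm.mul_apply, hOpPerm_apply ε hi, hOpPerm_apply ε hj]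
    exact hOp_comm ε i j hi hj hij f
  braid i hi2 := by
    have hi : i + 1 < n := by omega
    ext1 f
    simp only [Equiv.Perm.mul_apply, hOpPerm_apply ε hi, hOpPerm_apply ε hi2]
    exact hOp_braid ε i hi hi2 f

end HOp

/-- For each choice of sign, the assignment `s_i ↦ ŝ_i^±` defines an action
of `S_n` on `ℂ(z_1,…,z_n,h)`; that is, the scalar operators `ŝ_i^±` satisfy the Coxeter
relations of the symmetric group. -/
theorem statement2 (n : ℕ) (ε : Bool) :
    (∀ (i : ℕ) (hi : i + 1 < n) (f : K n), hOp ε i hi (hOp ε i hi f) = f) ∧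
    (∀ (i j : ℕ) (hi : i + 1 < n) (hj : j + 1 < n), i + 1 < j →
      ∀ f : K n, hOp ε i hi (hOp ε j hj f) = hOp ε j hj (hOp ε i hi f)) ∧
    (∀ (i : ℕ) (hi : i + 1 < n) (hi2 : i + 1 + 1 < n) (f : K n),
      hOp ε i hi (hOp ε (i+1) hi2 (hOp ε i hi f)) =
        hOp ε (i+1) hi2 (hOp ε i hi (hOp ε (i+1) hi2 f))) ∧
    (∃ ρ : Equiv.Perm (Fin n) →* Function.End (K n),
      ∀ (i : ℕ) (hi : i + 1 < n),
        ρ (Equiv.swap (fin1 i hi) (fin2 i hi)) = hOp ε i hi) := by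
  refine ⟨hOp_hOp ε, hOp_comm ε, hOp_braid ε, ?_⟩
  obtain ⟨ρ, hρ⟩ := (isCoxeterFamily_hOpPerm n ε).exists_monoidHom
  refine ⟨(MulAction.toEndHom (M := Equiv.Perm (K n))).comp ρ, fun i hi ↦ funext fun f ↦ ?_⟩
  rw [← adjSwap_of_lt hi, MonoidHom.comp_apply, hρ i hi]
  exact hOpPerm_apply ε hi f

end GRTV
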